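/- Let ℓ, k be positive integers, D ⊆ ℝ^ℓ a convex set, and σ : ℝ^ℓ → ℝ^k an affine map. Then for every δ > 0 there exists a family 𝓗 of affine subspaces of ℝ^ℓ satisfying: (i) |𝓗| ≤ ∏_{i=1}^{k} (1 + ((1+δ)/δ)·Flt(i)); (ii) D ∩ σ⁻¹(ℤ^k) ⊆ ⋃_{H∈𝓗} H; and (iii) rdist((D∩H)_σ, D∩H) ≤ δ for each H ∈ 𝓗, where (D∩H)_σ := conv(D ∩ H ∩ σ⁻¹(ℤ^k)). -/

import Mathlib

open scoped ENNReal Pointwise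

/-- The relative distance between two sets `A ⊆ B ⊆ ℝ^ι`:
`rdist(A,B) = sup_{π linear} d_H(π(A),π(B)) / diam(π(A))`, computed in `ℝ≥0∞`,
so that a fraction with `∞` in the denominator as well as `0/0` is `0`,
`rdist(∅,∅) = 0` and `rdist(∅,B) = ∞` for `B ≠ ∅`. -/
noncomputable def relDist {ι : Type*} (A B : Set (ι → ℝ)) : ℝ≥0∞ :=
  ⨆ π : (ι → ℝ) →ₗ[ℝ] ℝ,
    (⨆ b ∈ B, ⨅ a ∈ A, ENNReal.ofReal |π b - π a|) /
      (⨆ a ∈ A, ⨆ a' ∈ A, ENNReal.ofReal |π a - π a'|)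

/-- A point of `ℝ^k` all of whose coordinates are integers. -/
def IsLatticePoint {k : ℕ} (z : Fin k → ℝ) : Prop := ∀ i, ∃ n : ℤ, z i = (n : ℝ)

/-- The lattice width of a set `B ⊆ ℝ^k`:
`width(B) = inf_{v ∈ ℤ^k \ {0}} (sup_{x ∈ B} vᵀx - inf_{x ∈ B} vᵀx)`, in `ℝ≥0∞`. -/
noncomputable def latticeWidth {k : ℕ} (B : Set (Fin k → ℝ)) : ℝ≥0∞ :=
  ⨅ v ∈ {v : Fin k → ℤ | v ≠ 0},
    ⨆ x ∈ B, ⨆ y ∈ B, ENNReal.ofReal (∑ i, (v i : ℝ) * (x i - y i))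

/-- The flatness constant `Flt(k)`: the smallest `λ` bounding the lattice width of every
convex, closed, full-dimensional and lattice-free subset of `ℝ^k`. -/
noncomputable def flatnessConst (k : ℕ) : ℝ≥0∞ :=
  ⨆ B ∈ {B : Set (Fin k → ℝ) | Convex ℝ B ∧ IsClosed B ∧ affineSpan ℝ B = ⊤ ∧
      ∀ x ∈ B, ¬ IsLatticePoint x}, latticeWidth B

/-- Every nonzero integer vector is a multiple of the first row of a unimodular matrix. -/
lemma exists_unimodular {n : ℕ} {v : Fin (n + 1) → ℤ} (hv : v ≠ 0) :
    ∃ (M M' : Matrix (Fin (n + 1)) (Fin (n + 1)) ℤ) (g : ℤ),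
      M * M' = 1 ∧ g ≠ 0 ∧ v = g • M 0 := by
  obtain ⟨r, ⟨b, bN, f, a, snf⟩⟩ :=
    Submodule.smithNormalForm (Pi.basisFun ℤ (Fin (n + 1))) (Submodule.span ℤ {v})
  have hr : r = 1 := by
    have h := Module.finrank_eq_card_basis bN
    rw [← (LinearEquiv.toSpanNonzeroSingleton ℤ _ v hv).finrank_eq, Module.finrank_self] at h
    simpa using h.symm
  subst hr
  obtain ⟨c, hc⟩ : ∃ c : ℤ, v = c • b (f 0) := by
    have h := bN.sum_repr ⟨v, Submodule.mem_span_singleton_self v⟩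
    have h' := congrArg Subtype.val h
    simp only [Finset.univ_unique, Finset.sum_singleton, Submodule.coe_smul] at h'
    rw [Subsingleton.elim default (0 : Fin 1), snf, smul_smul] at h'
    exact ⟨_, h'.symm⟩
  set b' := b.reindex (Equiv.swap (f 0) 0) with hb'
  refine ⟨((Pi.basisFun ℤ _).toMatrix b').transpose, (b'.toMatrix (Pi.basisFun ℤ _)).transpose,
    c, ?_, ?_, ?_⟩
  · rw [← Matrix.transpose_mul, Module.Basis.toMatrix_mul_toMatrix_flip, Matrix.transpose_one]
  · rintro rfl
    exact hv (by simpa using hc)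
  · rw [hc]
    ext j
    simp [Module.Basis.toMatrix_apply, hb']

/-- If the slice `φ = j` of a convex set is thin in the direction `u` and lies well inside the range
of `φ`, then the whole set is thin in some direction `u - α φ`. -/
lemma exists_slope_of_thin_slice {E : Type*} [AddCommGroup E] [Module ℝ E] {K : Set E}
    (hK : Convex ℝ K) (φ u : E →ₗ[ℝ] ℝ) {A B : E} (hA : A ∈ K) (hB : B ∈ K) {j h s : ℝ}
    (hh : 0 < h) (hAj : h ≤ j - φ A) (hBj : h ≤ φ B - j)
    (hφ : ∀ x ∈ K, ∀ y ∈ K, φ x - φ y ≤ 6 * h)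
    (hs : ∀ x ∈ K, ∀ y ∈ K, φ x = j → φ y = j → u x - u y ≤ s) :
    ∃ α : ℝ, ∀ x ∈ K, ∀ y ∈ K, (u x - u y) - α * (φ x - φ y) ≤ 12 * s := by
  have hAB : 0 < φ B - φ A := by linarith
  set α := (u B - u A) / (φ B - φ A) with hα
  have hαAB : u B - u A = α * (φ B - φ A) := by rw [hα]; field_simp
  have cross : ∀ P ∈ K, ∀ X ∈ K, ∀ τ : ℝ, 0 ≤ τ → τ ≤ 1 → φ P + τ * (φ X - φ P) = j →
      ∃ Y ∈ K, φ Y = j ∧ u Y = u P + τ * (u X - u P) := by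
    intro P hP X hX τ h0 h1 hj
    refine ⟨P + τ • (X - P), hK.add_smul_sub_mem hP hX ⟨h0, h1⟩, ?_, ?_⟩
    · simpa using hj
    · simp
  obtain ⟨C, hC, hCj, hCu⟩ := cross A hA B hB ((j - φ A) / (φ B - φ A))
    (div_nonneg (by linarith) hAB.le) ((div_le_one hAB).2 (by linarith)) (by field_simp; ring)
  have hCf : u C - u A = α * (j - φ A) := by rw [hCu, hαAB]; field_simp; ring
  have main : ∀ P ∈ K, u P - u A = α * (φ P - φ A) → ∀ X ∈ K, ∀ τ : ℝ, 1 / 6 ≤ τ → τ ≤ 1 →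
      φ P + τ * (φ X - φ P) = j → |u X - u A - α * (φ X - φ A)| ≤ 6 * s := by
    intro P hP hPu X hX τ h0 h1 hj
    obtain ⟨Y, hY, hYj, hYu⟩ := cross P hP X hX τ (by linarith) h1 hj
    have e : τ * (u X - u A - α * (φ X - φ A)) = u Y - u C := by
      rw [hYu]
      linear_combination (-1 + τ) * hPu + hCf - α * hj
    have hle : |τ * (u X - u A - α * (φ X - φ A))| ≤ s := by
      rw [e, abs_le]
      have h1 := hs Y hY C hC hYj hCj
      have h2 := hs C hC Y hY hCj hYj
      constructor <;> linarith
    rw [abs_mul, abs_of_nonneg (by linarith)] at hle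
    nlinarith [abs_nonneg (u X - u A - α * (φ X - φ A))]
  have bound : ∀ X ∈ K, |u X - u A - α * (φ X - φ A)| ≤ 6 * s := by
    intro X hX
    rcases le_total j (φ X) with hjX | hjX
    · have h0 : 0 < φ X - φ A := by linarith
      refine main A hA (by ring) X hX ((j - φ A) / (φ X - φ A)) ?_ ?_ (by field_simp; ring)
      · rw [div_le_div_iff₀ (by norm_num) h0]
        linarith [hφ X hX A hA]
      · exact (div_le_one h0).2 (by linarith)
    · have h0 : 0 < φ B - φ X := by linarith
      refine main B hB hαAB X hX ((φ B - j) / (φ B - φ X)) ?_ ?_ (by field_simp; ring)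
      · rw [div_le_div_iff₀ (by norm_num) h0]
        linarith [hφ B hB X hX]
      · exact (div_le_one h0).2 (by linarith)
  refine ⟨α, fun x hx y hy => ?_⟩
  have h1 := abs_le.1 (bound x hx)
  have h2 := abs_le.1 (bound y hy)
  linarith [h1.2, h2.1]

/-- The linear form `x ↦ vᵀx` on `ℝ^n` given by an integer vector `v`. -/
noncomputable def intForm {n : ℕ} (v : Fin n → ℤ) : (Fin n → ℝ) →ₗ[ℝ] ℝ :=
  ∑ i, (v i : ℝ) • LinearMap.proj i

lemma intForm_apply {n : ℕ} (v : Fin n → ℤ) (x : Fin n → ℝ) :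
    intForm v x = ∑ i, (v i : ℝ) * x i := by
  simp [intForm]

lemma sum_mul_sub_eq_intForm {n : ℕ} (v : Fin n → ℤ) (x y : Fin n → ℝ) :
    ∑ i, (v i : ℝ) * (x i - y i) = intForm v x - intForm v y := by
  simp [intForm_apply, mul_sub, Finset.sum_sub_distrib]

lemma isLatticePoint_iff {n : ℕ} {x : Fin n → ℝ} :
    IsLatticePoint x ↔ ∃ z : Fin n → ℤ, x = fun i => (z i : ℝ) := by
  refine ⟨fun h => ?_, ?_⟩
  · choose z hz using h
    exact ⟨z, funext hz⟩
  · rintro ⟨z, rfl⟩ i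
    exact ⟨z i, rfl⟩

lemma IsLatticePoint.mulVec {n : ℕ} (M : Matrix (Fin n) (Fin n) ℤ) {x : Fin n → ℝ}
    (hx : IsLatticePoint x) : IsLatticePoint ((M.map (Int.cast : ℤ → ℝ)).mulVec x) := by
  obtain ⟨z, rfl⟩ := isLatticePoint_iff.1 hx
  intro i
  exact ⟨M.mulVec z i, by simp [Matrix.mulVec, dotProduct]⟩

lemma IsLatticePoint.intForm {n : ℕ} (v : Fin n → ℤ) {x : Fin n → ℝ} (hx : IsLatticePoint x) :
    ∃ m : ℤ, intForm v x = m := by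
  obtain ⟨z, rfl⟩ := isLatticePoint_iff.1 hx
  exact ⟨∑ i, v i * z i, by simp [intForm_apply]⟩

lemma exists_lattice_equiv {n : ℕ} {v : Fin (n + 1) → ℤ} (hv : v ≠ 0) :
    ∃ (U : (Fin (n + 1) → ℝ) ≃ₗ[ℝ] (Fin (n + 1) → ℝ)) (g : ℤ), g ≠ 0 ∧
      (∀ x, IsLatticePoint (U x) ↔ IsLatticePoint x) ∧
      (∀ x, intForm v x = g * U x 0) ∧
      ∀ u : Fin (n + 1) → ℤ, u ≠ 0 →
        ∃ u' : Fin (n + 1) → ℤ, u' ≠ 0 ∧ ∀ x, intForm u (U x) = intForm u' x := by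
  obtain ⟨M, M', g, hM, hg, hvg⟩ := exists_unimodular hv
  have hM' : M' * M = 1 := mul_eq_one_comm.1 hM
  have key : ∀ A B : Matrix (Fin (n + 1)) (Fin (n + 1)) ℤ, A * B = 1 →
      A.map (Int.cast : ℤ → ℝ) * B.map (Int.cast : ℤ → ℝ) = 1 := by
    intro A B h
    exact (Matrix.map_mul (f := Int.castRingHom ℝ)).symm.trans (by rw [h]; simp)
  refine ⟨Matrix.toLin'OfInv (key _ _ hM') (key _ _ hM), g, hg, fun x => ⟨fun h => ?_, ?_⟩,
    fun x => ?_, fun u hu => ⟨Matrix.vecMul u M, fun h => hu ?_, fun x => ?_⟩⟩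
  · have := h.mulVec M'
    simpa [Matrix.toLin'OfInv, Matrix.mulVec_mulVec, key _ _ hM'] using this
  · intro h
    simpa [Matrix.toLin'OfInv] using h.mulVec M
  · simp [hvg, intForm_apply, Matrix.toLin'OfInv, Matrix.mulVec, dotProduct, Finset.mul_sum,
      mul_assoc]
  · have : Matrix.vecMul (Matrix.vecMul u M) M' = u := by simp [Matrix.vecMul_vecMul, hM]
    rw [← this, h, Matrix.zero_vecMul]
  · simp only [intForm_apply, Matrix.toLin'OfInv, Matrix.vecMul, dotProduct, LinearEquiv.coe_mk,
      Int.cast_sum, Int.cast_mul, Finset.sum_mul, LinearMap.coe_mk]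
    rw [Finset.sum_comm]
    simp [Matrix.mulVec, dotProduct, Finset.mul_sum, mul_assoc]

/-- Induction step of the flatness theorem, when the first coordinate direction attains the lattice
width up to a factor `3 / 2`. -/
lemma exists_flatness_bound_of_near_minimal {n : ℕ} {K : Set (Fin (n + 1) → ℝ)}
    (hK : Convex ℝ K) (hbdd : ∀ v, ∃ C : ℝ, ∀ x ∈ K, ∀ y ∈ K, intForm v x - intForm v y ≤ C)
    {s w : ℝ} (hw : 72 * s + 3 ≤ w) (hw3 : 3 ≤ w)
    (ih : ∀ L : Set (Fin n → ℝ), Convex ℝ L → L.Nonempty →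
      (∀ v, ∃ C : ℝ, ∀ x ∈ L, ∀ y ∈ L, intForm v x - intForm v y ≤ C) →
      (∀ v, v ≠ 0 → ∃ x ∈ L, ∃ y ∈ L, s ≤ intForm v x - intForm v y) →
      ∃ x ∈ L, IsLatticePoint x)
    (hle : ∀ x ∈ K, ∀ y ∈ K, x 0 - y 0 ≤ w)
    (hmin : ∀ v, v ≠ 0 → ∃ x ∈ K, ∃ y ∈ K, 2 / 3 * w < intForm v x - intForm v y) :
    ∃ x ∈ K, IsLatticePoint x := by
  have form_cons : ∀ (a : ℤ) (u : Fin n → ℤ) (x : Fin (n + 1) → ℝ),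
      intForm (Fin.cons a u) x = a * x 0 + intForm u (Fin.tail x) := by
    intro a u x
    simp [intForm_apply, Fin.sum_univ_succ, Fin.tail]
  obtain ⟨B, hB, A, hA, hAB⟩ := hmin (Fin.cons 1 0) (fun h => by simpa using congrFun h 0)
  have hz : ∀ x, intForm (0 : Fin n → ℤ) x = 0 := by simp [intForm_apply]
  simp only [form_cons, hz, Int.cast_one, one_mul, add_zero] at hAB
  set j : ℤ := round ((A 0 + B 0) / 2) with hj
  have hj' := abs_le.1 (abs_sub_round ((A 0 + B 0) / 2))
  rw [← hj] at hj'
  have hAj : w / 6 ≤ (j : ℝ) - A 0 := by linarith [hj'.1, hj'.2]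
  have hBj : w / 6 ≤ B 0 - (j : ℝ) := by linarith [hj'.1, hj'.2]
  set L : Set (Fin n → ℝ) := {y | (Fin.cons (j : ℝ) y : Fin (n + 1) → ℝ) ∈ K} with hL
  have mem_L : ∀ x ∈ K, x 0 = j → Fin.tail x ∈ L := by
    intro x hx hxj
    simpa [hL, ← hxj] using hx
  by_contra! hno
  have hne : L.Nonempty := by
    have hpos : 0 < B 0 - A 0 := by linarith
    refine ⟨_, mem_L (A + (((j : ℝ) - A 0) / (B 0 - A 0)) • (B - A))
      (hK.add_smul_sub_mem hA hB ⟨div_nonneg (by linarith) hpos.le,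
        (div_le_one hpos).2 (by linarith)⟩) ?_⟩
    simp only [Pi.add_apply, Pi.smul_apply, Pi.sub_apply, smul_eq_mul]
    field_simp
    ring
  have hLconv : Convex ℝ L := by
    intro x hx y hy a b ha hb hab
    have h := hK hx hy ha hb hab
    change Fin.cons _ _ ∈ K
    convert h using 1
    ext i
    refine Fin.cases ?_ (fun i => ?_) i
    · simp [← add_mul, hab]
    · simp
  obtain ⟨u, hu, hus⟩ : ∃ u : Fin n → ℤ, u ≠ 0 ∧
      ∀ x ∈ L, ∀ y ∈ L, intForm u x - intForm u y < s := by
    by_contra! hcon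
    have hLbdd : ∀ v, ∃ C : ℝ, ∀ x ∈ L, ∀ y ∈ L, intForm v x - intForm v y ≤ C := by
      intro v
      obtain ⟨C, hC⟩ := hbdd (Fin.cons 0 v)
      refine ⟨C, fun x hx y hy => ?_⟩
      have h := hC _ hx _ hy
      simp only [form_cons] at h
      simpa using h
    obtain ⟨x, hx, hxl⟩ := ih L hLconv hne hLbdd hcon
    refine hno _ hx fun i => ?_
    refine Fin.cases ⟨j, by simp⟩ (fun i => ?_) i
    simpa using hxl i
  obtain ⟨α, hα⟩ := exists_slope_of_thin_slice hK (LinearMap.proj 0)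
    (intForm (Fin.cons 0 u)) hA hB (j := j) (h := w / 6) (s := s) (by linarith) hAj hBj
    (fun x hx y hy => by simpa using (hle x hx y hy).trans_eq (by ring))
    (fun x hx y hy hxj hyj => by
      simpa [form_cons] using (hus _ (mem_L x hx hxj) _ (mem_L y hy hyj)).le)
  obtain ⟨x, hx, y, hy, hxy⟩ := hmin (Fin.cons (-round α) u) (fun h => hu (by
    ext i
    simpa using congrFun h i.succ))
  have h1 := hα x hx y hy
  simp only [form_cons, LinearMap.proj_apply] at h1 hxy
  push_cast at h1 hxy
  have h2 : (α - round α) * (x 0 - y 0) ≤ 1 / 2 * w := by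
    refine (le_abs_self _).trans ?_
    rw [abs_mul]
    refine mul_le_mul (abs_sub_round α) (abs_le.2 ⟨?_, hle x hx y hy⟩) (abs_nonneg _) (by norm_num)
    linarith [hle y hy x hx]
  nlinarith

/-- Flatness theorem for convex sets bounded in every lattice direction. -/
lemma exists_flatness_bound (n : ℕ) :
    ∃ W : ℝ, 0 < W ∧ ∀ K : Set (Fin n → ℝ), Convex ℝ K → K.Nonempty →
      (∀ v, ∃ C : ℝ, ∀ x ∈ K, ∀ y ∈ K, intForm v x - intForm v y ≤ C) →
      (∀ v, v ≠ 0 → ∃ x ∈ K, ∃ y ∈ K, W ≤ intForm v x - intForm v y) →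
      ∃ x ∈ K, IsLatticePoint x := by
  induction n with
  | zero => exact ⟨1, one_pos, fun K _ hne _ _ => hne.imp fun x hx => ⟨hx, fun i => i.elim0⟩⟩
  | succ n ih =>
    obtain ⟨s, hs, ih⟩ := ih
    refine ⟨72 * s + 3, by positivity, fun K hK hne hbdd hW => ?_⟩
    set I : Set ℝ := {w | ∃ v : Fin (n + 1) → ℤ, v ≠ 0 ∧
      ∀ x ∈ K, ∀ y ∈ K, intForm v x - intForm v y ≤ w} with hI
    have hlow : ∀ w ∈ I, 72 * s + 3 ≤ w := by
      rintro w ⟨v, hv, hvw⟩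
      obtain ⟨x, hx, y, hy, hxy⟩ := hW v hv
      exact hxy.trans (hvw x hx y hy)
    have hIne : I.Nonempty := by
      obtain ⟨C, hC⟩ := hbdd (fun _ => 1)
      exact ⟨C, _, fun h => one_ne_zero (congrFun h 0), hC⟩
    have hinf : 72 * s + 3 ≤ sInf I := le_csInf hIne hlow
    obtain ⟨w, ⟨v, hv, hvw⟩, hw⟩ := exists_lt_of_csInf_lt hIne
      (show sInf I < 3 / 2 * sInf I by linarith)
    have hnot : ∀ v : Fin (n + 1) → ℤ, v ≠ 0 →
        ∃ x ∈ K, ∃ y ∈ K, 2 / 3 * w < intForm v x - intForm v y := by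
      intro v hv
      by_contra! hcon
      have := csInf_le ⟨_, hlow⟩ (show 2 / 3 * w ∈ I from ⟨v, hv, hcon⟩)
      linarith
    obtain ⟨U, g, hg, hUl, hUv, hUu⟩ := exists_lattice_equiv hv
    have hww : 72 * s + 3 ≤ w := hlow w ⟨v, hv, hvw⟩
    suffices h : ∃ x ∈ U '' K, IsLatticePoint x by
      obtain ⟨_, ⟨x, hx, rfl⟩, hxl⟩ := h
      exact ⟨x, hx, (hUl x).1 hxl⟩
    refine exists_flatness_bound_of_near_minimal (hK.linear_image U.toLinearMap) (s := s)
      (w := w) ?_ hww (by linarith) ih ?_ ?_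
    · intro u
      by_cases hu : u = 0
      · exact ⟨0, by simp [hu, intForm_apply]⟩
      obtain ⟨u', -, h⟩ := hUu u hu
      obtain ⟨C, hC⟩ := hbdd u'
      refine ⟨C, ?_⟩
      rintro _ ⟨x, hx, rfl⟩ _ ⟨y, hy, rfl⟩
      rw [h, h]
      exact hC x hx y hy
    · rintro _ ⟨x, hx, rfl⟩ _ ⟨y, hy, rfl⟩
      have h1 := hvw x hx y hy
      have h2 := hvw y hy x hx
      rw [hUv, hUv, ← mul_sub] at h1 h2
      have hg1 : (1 : ℝ) ≤ |(g : ℝ)| := by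
        exact_mod_cast Int.one_le_abs hg
      have h3 : |(g : ℝ) * (U x 0 - U y 0)| ≤ w := abs_le.2 ⟨by linarith, h1⟩
      rw [abs_mul] at h3
      exact (le_abs_self _).trans ((le_mul_of_one_le_left (abs_nonneg _) hg1).trans h3)
    · intro u hu
      obtain ⟨u', hu', h⟩ := hUu u hu
      obtain ⟨x, hx, y, hy, hxy⟩ := hnot u' hu'
      exact ⟨_, ⟨x, hx, rfl⟩, _, ⟨y, hy, rfl⟩, by rw [h, h]; exact hxy⟩

lemma continuous_intForm {n : ℕ} (v : Fin n → ℤ) : Continuous (intForm v) :=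
  (intForm v).continuous_of_finiteDimensional

lemma intForm_single {n : ℕ} (v : Fin n → ℤ) (i : Fin n) (a : ℝ) :
    intForm v (Pi.single i a) = v i * a := by
  simp [intForm_apply, Pi.single_apply]

/-- Flatness theorem: the flatness constant is finite. -/
lemma flatnessConst_ne_top (n : ℕ) : flatnessConst n ≠ ⊤ := by
  obtain ⟨W, hW, hflat⟩ := exists_flatness_bound n
  refine ne_top_of_le_ne_top (ENNReal.ofReal_ne_top (r := W)) (iSup₂_le ?_)
  rintro B ⟨hconv, -, hspan, hfree⟩
  obtain ⟨p, hp⟩ := hconv.interior_nonempty_iff_affineSpan_eq_top.2 hspan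
  obtain ⟨r, hr, hball⟩ := Metric.isOpen_iff.1 isOpen_interior p hp
  have htrunc : ∀ m : ℕ, ∃ v : Fin n → ℤ, v ≠ 0 ∧
      ∀ x ∈ B ∩ Metric.closedBall p (m + r), ∀ y ∈ B ∩ Metric.closedBall p (m + r),
        intForm v x - intForm v y < W := by
    intro m
    by_contra! hcon
    have hbdd : ∀ v, ∃ C : ℝ, ∀ x ∈ B ∩ Metric.closedBall p (m + r),
        ∀ y ∈ B ∩ Metric.closedBall p (m + r), intForm v x - intForm v y ≤ C := by
      intro v
      obtain ⟨C, hC⟩ := (isCompact_closedBall p (m + r)).exists_bound_of_continuousOn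
        (continuous_intForm v).continuousOn
      refine ⟨C + C, fun x hx y hy => ?_⟩
      have h1 := abs_le.1 (hC x hx.2)
      have h2 := abs_le.1 (hC y hy.2)
      linarith [h1.2, h2.1]
    obtain ⟨x, hx, hxl⟩ := hflat (B ∩ Metric.closedBall p (m + r))
      (hconv.inter (convex_closedBall _ _))
      ⟨p, interior_subset hp, Metric.mem_closedBall_self (by positivity)⟩ hbdd hcon
    exact hfree x hx.1 hxl
  choose v hv0 hv using htrunc
  have hmem : ∀ m, v m ∈ Set.Icc (fun _ => -⌈W / r⌉ : Fin n → ℤ) (fun _ => ⌈W / r⌉) := by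
    intro m
    have hq : ∀ i, ∀ a : ℝ, |a| = r / 2 →
        p + Pi.single i a ∈ B ∩ Metric.closedBall p (m + r) := by
      intro i a ha
      have hd : dist (p + Pi.single i a) p = r / 2 := by
        rw [dist_eq_norm, add_sub_cancel_left, Pi.norm_single, Real.norm_eq_abs, ha]
      refine ⟨interior_subset (hball ?_), ?_⟩
      · rw [Metric.mem_ball, hd]
        linarith
      · rw [Metric.mem_closedBall, hd]
        have : (0 : ℝ) ≤ m := m.cast_nonneg
        linarith
    have habs : ∀ i, |(v m i : ℝ)| ≤ W / r := by
      intro i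
      have h1 := hq i (r / 2) (abs_of_pos (by positivity))
      have h2 := hq i (-(r / 2)) (by rw [abs_neg, abs_of_pos (by positivity)])
      have h3 := hv m _ h1 _ h2
      have h4 := hv m _ h2 _ h1
      simp only [map_add, intForm_single] at h3 h4
      rw [abs_le, ← neg_div, div_le_iff₀ hr, le_div_iff₀ hr]
      constructor <;> linarith
    refine ⟨fun i => ?_, fun i => ?_⟩
    · have h1 := (abs_le.1 (habs i)).1
      have h2 := Int.le_ceil (W / r)
      have : (-⌈W / r⌉ : ℝ) ≤ v m i := by linarith
      exact_mod_cast this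
    · have h1 := ((abs_le.1 (habs i)).2).trans (Int.le_ceil (W / r))
      exact_mod_cast h1
  obtain ⟨u, hu⟩ := Finite.exists_infinite_fiber
    (fun m => (⟨v m, hmem m⟩ : Set.Icc (fun _ => -⌈W / r⌉ : Fin n → ℤ) (fun _ => ⌈W / r⌉)))
  have hu' := Set.infinite_coe_iff.1 hu
  have hfar : ∀ R : ℝ, ∃ m : ℕ, R ≤ m ∧ v m = u := by
    intro R
    obtain ⟨m, hm, hRm⟩ := hu'.exists_gt ⌈R⌉₊
    exact ⟨m, (Nat.le_ceil R).trans (by exact_mod_cast hRm.le), congrArg Subtype.val hm⟩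
  have hu0 : (u : Fin n → ℤ) ≠ 0 := by
    obtain ⟨m, -, hm⟩ := hfar 0
    exact hm ▸ hv0 m
  refine iInf₂_le_of_le (u : Fin n → ℤ) hu0 (iSup₂_le fun x hx => iSup₂_le fun y hy => ?_)
  refine ENNReal.ofReal_le_ofReal ?_
  rw [sum_mul_sub_eq_intForm]
  obtain ⟨m, hm, hmu⟩ := hfar (max (dist x p) (dist y p))
  rw [← hmu]
  refine (hv m x ⟨hx, ?_⟩ y ⟨hy, ?_⟩).le
  · exact Metric.mem_closedBall.2 (by linarith [le_max_left (dist x p) (dist y p)])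
  · exact Metric.mem_closedBall.2 (by linarith [le_max_right (dist x p) (dist y p)])

lemma exists_intForm_sub_le_of_latticeWidth_lt {n : ℕ} {B : Set (Fin n → ℝ)} {C : ℝ}
    (hC : 0 ≤ C) (h : latticeWidth B < ENNReal.ofReal C) :
    ∃ v : Fin n → ℤ, v ≠ 0 ∧ ∀ x ∈ B, ∀ y ∈ B, intForm v x - intForm v y ≤ C := by
  simp only [latticeWidth, iInf_lt_iff] at h
  obtain ⟨v, hv, hvlt⟩ := h
  refine ⟨v, hv, fun x hx y hy => ?_⟩
  have hx' := iSup₂_le_iff.1 hvlt.le x hx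
  have hy' := iSup₂_le_iff.1 hx' y hy
  rwa [ENNReal.ofReal_le_ofReal_iff hC, sum_mul_sub_eq_intForm] at hy'

lemma exists_intForm_sub_le {n : ℕ} {K : Set (Fin n → ℝ)} (hK : Convex ℝ K)
    (hspan : affineSpan ℝ K = ⊤) (hfree : ∀ x ∈ K, ¬ IsLatticePoint x) {ε : ℝ} (hε : 0 < ε) :
    ∃ v : Fin n → ℤ, v ≠ 0 ∧
      ∀ x ∈ K, ∀ y ∈ K, intForm v x - intForm v y ≤ (flatnessConst n).toReal + ε := by
  set F := (flatnessConst n).toReal with hF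
  have hF0 : 0 ≤ F := ENNReal.toReal_nonneg
  obtain ⟨c, hc⟩ := hK.interior_nonempty_iff_affineSpan_eq_top.2 hspan
  set t : ℝ := (F + ε / 2) / (F + ε) with ht
  have ht0 : 0 < t := by positivity
  have ht1 : t < 1 := (div_lt_one (by positivity)).2 (by linarith)
  have htF : t * (F + ε) = F + ε / 2 := by rw [ht]; field_simp
  set L : Set (Fin n → ℝ) := AffineMap.homothety c t⁻¹ ⁻¹' closure K with hL
  have hcont : Continuous (AffineMap.homothety c t⁻¹ : (Fin n → ℝ) →ᵃ[ℝ] (Fin n → ℝ)) :=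
    AffineMap.homothety_continuous c t⁻¹
  have hLconv : Convex ℝ L := hK.closure.affine_preimage _
  have hLspan : affineSpan ℝ L = ⊤ := by
    refine hLconv.interior_nonempty_iff_affineSpan_eq_top.1 ⟨c, ?_⟩
    refine preimage_interior_subset_interior_preimage hcont ?_
    rw [Set.mem_preimage, AffineMap.homothety_apply_same]
    exact interior_mono subset_closure hc
  have hLfree : ∀ x ∈ L, ¬ IsLatticePoint x := by
    intro x hx
    refine hfree x (interior_subset ?_)
    have h := hK.combo_interior_closure_mem_interior hc hx (sub_pos.2 ht1) ht0.le (by ring)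
    convert h using 1
    rw [AffineMap.homothety_apply]
    ext i
    simp
    field_simp
    ring
  have hlt : latticeWidth L < ENNReal.ofReal (F + ε / 2) := by
    refine lt_of_le_of_lt (le_iSup₂_of_le L
      ⟨hLconv, isClosed_closure.preimage hcont, hLspan, hLfree⟩ le_rfl)
      (show flatnessConst n < _ from ?_)
    rw [← ENNReal.ofReal_toReal (flatnessConst_ne_top n), ← hF]
    exact (ENNReal.ofReal_lt_ofReal_iff (by positivity)).2 (by linarith)
  obtain ⟨v, hv, hvL⟩ := exists_intForm_sub_le_of_latticeWidth_lt (by positivity) hlt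
  refine ⟨v, hv, fun x hx y hy => ?_⟩
  have hmem : ∀ x ∈ K, c + t • (x - c) ∈ L := by
    intro x hx
    rw [hL, Set.mem_preimage, AffineMap.homothety_apply]
    simpa [smul_smul, ht0.ne'] using subset_closure hx
  have h := hvL _ (hmem x hx) _ (hmem y hy)
  simp only [map_add, map_smul, map_sub, smul_eq_mul] at h
  refine le_of_mul_le_mul_left ?_ ht0
  linarith

lemma exists_intForm_eq_of_affineSpan_ne_top {n : ℕ} {Z : Set (Fin n → ℝ)}
    (hZ : ∀ z ∈ Z, IsLatticePoint z) (hne : Z.Nonempty) (hspan : affineSpan ℝ Z ≠ ⊤) :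
    ∃ v : Fin n → ℤ, v ≠ 0 ∧ ∀ x ∈ Z, ∀ y ∈ Z, intForm v x = intForm v y := by
  set W : Submodule ℚ (Fin n → ℚ) :=
    Submodule.span ℚ {q | (fun i => (q i : ℝ)) ∈ vectorSpan ℝ Z} with hW
  have hmem : ∀ q ∈ W, (fun i => (q i : ℝ)) ∈ vectorSpan ℝ Z := by
    intro q hq
    induction hq using Submodule.span_induction with
    | mem q hq => exact hq
    | zero => convert (vectorSpan ℝ Z).zero_mem; simp
    | add q r _ _ hq hr => convert (vectorSpan ℝ Z).add_mem hq hr; simp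
    | smul a q _ hq => convert (vectorSpan ℝ Z).smul_mem (a : ℝ) hq; simp
  have hWtop : W < ⊤ := by
    refine lt_top_iff_ne_top.2 fun htop => hspan ?_
    rw [AffineSubspace.affineSpan_eq_top_iff_vectorSpan_eq_top_of_nonempty ℝ _ _ hne,
      eq_top_iff, ← (Pi.basisFun ℝ (Fin n)).span_eq, Submodule.span_le]
    rintro _ ⟨i, rfl⟩
    have h := hmem (Pi.single i 1) (htop ▸ Submodule.mem_top)
    have e : Pi.basisFun ℝ (Fin n) i = fun j => ((Pi.single i 1 : Fin n → ℚ) j : ℝ) := by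
      ext j
      by_cases hij : j = i <;> simp [hij]
    rwa [SetLike.mem_coe, e]
  obtain ⟨f, hf, hWf⟩ := Submodule.exists_le_ker_of_lt_top W hWtop
  obtain ⟨b, hb⟩ := IsLocalization.exist_integer_multiples (nonZeroDivisors ℤ) Finset.univ
    (fun i : Fin n => f (Pi.single i 1))
  choose v hv using fun i => hb i (Finset.mem_univ i)
  have hb0 : ((b : ℤ) : ℚ) ≠ 0 := by
    exact_mod_cast nonZeroDivisors.ne_zero b.2
  have hvf : ∀ i, (v i : ℚ) = b * f (Pi.single i 1) := by
    intro i
    simpa using hv i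
  refine ⟨v, fun h => hf ?_, fun x hx y hy => ?_⟩
  · refine (Pi.basisFun ℚ (Fin n)).ext fun i => ?_
    have := hvf i
    simp only [h, Pi.zero_apply, Int.cast_zero] at this
    simpa [hb0] using this.symm
  · obtain ⟨x, rfl⟩ := isLatticePoint_iff.1 (hZ x hx)
    obtain ⟨y, rfl⟩ := isLatticePoint_iff.1 (hZ y hy)
    have hq : (fun i => ((x i : ℚ) - y i)) ∈ W := by
      refine Submodule.subset_span ?_
      convert vsub_mem_vectorSpan ℝ hx hy
      simp [Pi.sub_def]
    have h0 : f (fun i => ((x i : ℚ) - y i)) = 0 := hWf hq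
    rw [LinearMap.pi_apply_eq_sum_univ] at h0
    have h1 : ∑ i, (v i : ℚ) * (x i - y i) = 0 := by
      simp only [hvf]
      rw [← mul_zero ((b : ℤ) : ℚ), ← h0, Finset.mul_sum]
      refine Finset.sum_congr rfl fun i _ => ?_
      have : (fun j => if i = j then (1 : ℚ) else 0) = Pi.single i 1 := by
        ext j
        simp [Pi.single_apply, eq_comm]
      rw [this, smul_eq_mul]
      ring
    rw [← sub_eq_zero, ← sum_mul_sub_eq_intForm]
    exact_mod_cast h1

lemma exists_finset_of_sub_le {T : Set ℤ} (hT : T.Nonempty) {N : ℕ}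
    (h : ∀ s ∈ T, ∀ t ∈ T, s - t ≤ N) : ∃ T' : Finset ℤ, T'.card = N + 1 ∧ T ⊆ T' := by
  obtain ⟨t₀, ht₀⟩ := hT
  obtain ⟨m, hm, hmin⟩ := Int.exists_least_of_bdd (P := (· ∈ T))
    ⟨t₀ - N, fun z hz => by linarith [h t₀ ht₀ z hz]⟩ ⟨t₀, ht₀⟩
  refine ⟨Finset.Icc m (m + N), by simp; omega, fun t ht => ?_⟩
  rw [Finset.mem_coe, Finset.mem_Icc]
  exact ⟨hmin t ht, by linarith [h t ht m hm]⟩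

/-- A set of lattice points of bounded width is covered by few lattice hyperplanes, which become
parallel to a coordinate hyperplane in suitable lattice coordinates. -/
lemma exists_lattice_slicing {n : ℕ} {Z : Set (Fin (n + 1) → ℝ)}
    (hZ : ∀ z ∈ Z, IsLatticePoint z) (hne : Z.Nonempty) {c : ℝ} (hc : 0 < c)
    (hwidth : affineSpan ℝ Z = ⊤ → ∀ ε : ℝ, 0 < ε → ∃ v : Fin (n + 1) → ℤ, v ≠ 0 ∧
      ∀ x ∈ Z, ∀ y ∈ Z,
        intForm v x - intForm v y ≤ c * ((flatnessConst (n + 1)).toReal + ε)) :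
    ∃ (U : (Fin (n + 1) → ℝ) ≃ₗ[ℝ] (Fin (n + 1) → ℝ)) (T : Finset ℤ),
      (∀ x, IsLatticePoint (U x) ↔ IsLatticePoint x) ∧
      (T.card : ℝ≥0∞) ≤ 1 + ENNReal.ofReal c * flatnessConst (n + 1) ∧
      ∀ z ∈ Z, ∃ t ∈ T, U z 0 = t := by
  set F := (flatnessConst (n + 1)).toReal with hF
  have hF0 : 0 ≤ c * F := mul_nonneg hc.le ENNReal.toReal_nonneg
  obtain ⟨v, hv, hvN⟩ : ∃ v : Fin (n + 1) → ℤ, v ≠ 0 ∧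
      ∀ x ∈ Z, ∀ y ∈ Z, intForm v x - intForm v y ≤ (⌊c * F⌋₊ : ℝ) := by
    by_cases hspan : affineSpan ℝ Z = ⊤
    · have hfl := Nat.lt_floor_add_one (c * F)
      obtain ⟨v, hv, hvle⟩ := hwidth hspan ((⌊c * F⌋₊ + 1 - c * F) / (2 * c))
        (div_pos (by linarith) (by positivity))
      refine ⟨v, hv, fun x hx y hy => ?_⟩
      have h := hvle x hx y hy
      have e : c * (F + (⌊c * F⌋₊ + 1 - c * F) / (2 * c)) = (c * F + (⌊c * F⌋₊ + 1)) / 2 := by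
        field_simp
        ring
      rw [e] at h
      obtain ⟨a, ha⟩ := (hZ x hx).intForm v
      obtain ⟨b, hb⟩ := (hZ y hy).intForm v
      rw [ha, hb] at h ⊢
      have h' : (a : ℝ) - b < ⌊c * F⌋₊ + 1 := by linarith
      have h'' : a - b < ⌊c * F⌋₊ + 1 := by exact_mod_cast h'
      exact_mod_cast Int.lt_add_one_iff.1 h''
    · obtain ⟨v, hv, h⟩ := exists_intForm_eq_of_affineSpan_ne_top hZ hne hspan
      exact ⟨v, hv, fun x hx y hy => by rw [h x hx y hy, sub_self]; positivity⟩
  obtain ⟨U, g, hg, hUl, hUv, -⟩ := exists_lattice_equiv hv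
  have hT : ∀ s ∈ {t : ℤ | ∃ z ∈ Z, U z 0 = t}, ∀ t ∈ {t : ℤ | ∃ z ∈ Z, U z 0 = t},
      s - t ≤ (⌊c * F⌋₊ : ℤ) := by
    rintro s ⟨x, hx, hxs⟩ t ⟨y, hy, hyt⟩
    have h1 := hvN x hx y hy
    have h2 := hvN y hy x hx
    rw [hUv, hUv, hxs, hyt] at h1 h2
    have h1' : g * s - g * t ≤ (⌊c * F⌋₊ : ℤ) := by exact_mod_cast h1
    have h2' : g * t - g * s ≤ (⌊c * F⌋₊ : ℤ) := by exact_mod_cast h2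
    have h3 : |g * (s - t)| ≤ (⌊c * F⌋₊ : ℤ) := abs_le.2 ⟨by linarith, by linarith⟩
    rw [abs_mul] at h3
    exact (le_abs_self _).trans
      ((le_mul_of_one_le_left (abs_nonneg _) (Int.one_le_abs hg)).trans h3)
  have hlat : ∀ z ∈ Z, ∃ t : ℤ, U z 0 = t := fun z hz => (hUl z).2 (hZ z hz) 0
  obtain ⟨z₀, hz₀⟩ := hne
  obtain ⟨t₀, ht₀⟩ := hlat z₀ hz₀
  obtain ⟨T, hTcard, hTsub⟩ := exists_finset_of_sub_le
    (T := {t : ℤ | ∃ z ∈ Z, U z 0 = t}) ⟨t₀, z₀, hz₀, ht₀⟩ hT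
  refine ⟨U, T, hUl, ?_, fun z hz => ?_⟩
  · rw [hTcard, ← ENNReal.ofReal_toReal (flatnessConst_ne_top (n + 1)), ← hF,
      ← ENNReal.ofReal_mul hc.le, add_comm, Nat.cast_add, Nat.cast_one]
    gcongr
    rw [← ENNReal.ofReal_natCast]
    exact ENNReal.ofReal_le_ofReal (Nat.floor_le hF0)
  · obtain ⟨t, ht⟩ := hlat z hz
    exact ⟨t, hTsub ⟨z, hz, ht⟩, ht⟩

/-- If `rdist(A,B) > δ`, contracting `A` towards a suitable point of `B` by the factor `δ / (1 + δ)`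
moves it strictly to one side of `A`. -/
lemma exists_separation_of_lt_relDist {ι : Type*} {A B : Set (ι → ℝ)} (hA : Convex ℝ A)
    {δ : ℝ} (hδ : 0 < δ) (h : ENNReal.ofReal δ < relDist A B) :
    ∃ b ∈ B, ∃ π : (ι → ℝ) →ₗ[ℝ] ℝ, ∀ a ∈ A, ∀ a' ∈ A,
      δ / (1 + δ) * (π b - π a) < π b - π a' := by
  obtain ⟨π, hπ⟩ := lt_iSup_iff.1 h
  have hπ' := lt_of_not_ge fun hle => hπ.not_ge (ENNReal.div_le_of_le_mul hle)
  obtain ⟨b, hb⟩ := lt_iSup_iff.1 hπ'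
  obtain ⟨hbB, hb⟩ := lt_iSup_iff.1 hb
  have hgap : ∀ a ∈ A, ∀ a₁ ∈ A, ∀ a₂ ∈ A, δ * |π a₁ - π a₂| < |π b - π a| := by
    intro a ha a₁ ha₁ a₂ ha₂
    have h1 : ENNReal.ofReal |π a₁ - π a₂| ≤
        ⨆ a ∈ A, ⨆ a' ∈ A, ENNReal.ofReal |π a - π a'| :=
      le_iSup₂_of_le a₁ ha₁ (le_iSup₂_of_le a₂ ha₂ le_rfl)
    have h2 := (mul_le_mul_right h1 (ENNReal.ofReal δ)).trans_lt (hb.trans_le (iInf₂_le a ha))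
    rw [← ENNReal.ofReal_mul hδ.le] at h2
    exact (ENNReal.ofReal_lt_ofReal_iff_of_nonneg (by positivity)).1 h2
  have hmem : π b ∉ π '' A := by
    rintro ⟨a, ha, hab⟩
    simpa [hab] using hgap a ha a ha a ha
  have hord := (hA.linear_image π).ordConnected
  have main : ∀ π' : (ι → ℝ) →ₗ[ℝ] ℝ,
      (∀ a ∈ A, ∀ a₁ ∈ A, ∀ a₂ ∈ A, δ * |π' a₁ - π' a₂| < |π' b - π' a|) →
      (∀ a ∈ A, π' a < π' b) → ∀ a ∈ A, ∀ a' ∈ A,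
        δ / (1 + δ) * (π' b - π' a) < π' b - π' a' := by
    intro π' hgap' hlt a ha a' ha'
    have h1 := hgap' a' ha' a' ha' a ha
    rw [abs_of_pos (sub_pos.2 (hlt a' ha'))] at h1
    have h2 := mul_le_mul_of_nonneg_left (le_abs_self (π' a' - π' a)) hδ.le
    rw [div_mul_eq_mul_div, div_lt_iff₀ (by positivity)]
    linarith
  by_cases hex : ∃ a ∈ A, π b < π a
  · obtain ⟨a₀, ha₀, hlt⟩ := hex
    refine ⟨b, hbB, -π, main (-π) ?_ fun a ha => ?_⟩
    · intro a ha a₁ ha₁ a₂ ha₂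
      simp only [LinearMap.neg_apply, neg_sub_neg]
      rw [abs_sub_comm (π a)]
      exact hgap a ha a₂ ha₂ a₁ ha₁
    · simp only [LinearMap.neg_apply, neg_lt_neg_iff]
      by_contra! hle
      exact hmem (hord.out ⟨a, ha, rfl⟩ ⟨a₀, ha₀, rfl⟩ ⟨hle, hlt.le⟩)
  · push Not at hex
    exact ⟨b, hbB, π, main π hgap fun a ha =>
      (hex a ha).lt_of_ne fun h => hmem ⟨a, ha, h⟩⟩

lemma exists_intForm_sub_le_of_lt_relDist {l n : ℕ} {D : Set (Fin l → ℝ)} (hD : Convex ℝ D)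
    (σ : (Fin l → ℝ) →ᵃ[ℝ] (Fin n → ℝ)) {δ : ℝ} (hδ : 0 < δ)
    (h : ENNReal.ofReal δ <
      relDist (convexHull ℝ (D ∩ {x | IsLatticePoint (σ x)})) D)
    (hspan : affineSpan ℝ (σ '' (D ∩ {x | IsLatticePoint (σ x)})) = ⊤) {ε : ℝ} (hε : 0 < ε) :
    ∃ v : Fin n → ℤ, v ≠ 0 ∧ ∀ x ∈ σ '' (D ∩ {x | IsLatticePoint (σ x)}),
      ∀ y ∈ σ '' (D ∩ {x | IsLatticePoint (σ x)}),
        intForm v x - intForm v y ≤ (1 + δ) / δ * ((flatnessConst n).toReal + ε) := by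
  set S := D ∩ {x | IsLatticePoint (σ x)} with hS
  obtain ⟨b, hb, π, hπ⟩ := exists_separation_of_lt_relDist (convex_convexHull ℝ S) hδ h
  have hA : convexHull ℝ S ⊆ D := convexHull_min Set.inter_subset_left hD
  have hr0 : 0 < δ / (1 + δ) := by positivity
  have hr1 : δ / (1 + δ) ≤ 1 := (div_le_one (by positivity)).2 (by linarith)
  set r := δ / (1 + δ) with hr
  set f := AffineMap.homothety (σ b) r with hf
  have hsurj : Function.Surjective f := fun y =>
    ⟨AffineMap.homothety (σ b) r⁻¹ y, by
      rw [hf, ← AffineMap.homothety_mul_apply, mul_inv_cancel₀ hr0.ne', AffineMap.homothety_one]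
      rfl⟩
  have hfree : ∀ x ∈ f '' convexHull ℝ (σ '' S), ¬ IsLatticePoint x := by
    rw [← σ.image_convexHull]
    rintro _ ⟨_, ⟨a, ha, rfl⟩, rfl⟩ hlat
    have hp : b + r • (a - b) ∈ D := hD.add_smul_sub_mem hb (hA ha) ⟨hr0.le, hr1⟩
    have e : σ (b + r • (a - b)) = f (σ a) := by
      have : b + r • (a - b) = AffineMap.homothety b r a := by
        rw [AffineMap.homothety_apply, vadd_eq_add, vsub_eq_sub, add_comm]
      rw [this, AffineMap.homothety_eq_lineMap, hf, AffineMap.homothety_eq_lineMap,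
        AffineMap.apply_lineMap]
    have hpS : b + r • (a - b) ∈ S := ⟨hp, by
      rw [Set.mem_ofPred_eq, e]
      exact hlat⟩
    have := hπ a ha _ (subset_convexHull ℝ S hpS)
    simp only [map_add, map_smul, map_sub, smul_eq_mul] at this
    linarith
  obtain ⟨v, hv, hvle⟩ := exists_intForm_sub_le
    ((convex_convexHull ℝ (σ '' S)).affine_image f)
    (f.span_eq_top_of_surjective hsurj (by rw [affineSpan_convexHull, hspan])) hfree hε
  refine ⟨v, hv, fun x hx y hy => ?_⟩
  have h := hvle _ ⟨x, subset_convexHull ℝ _ hx, rfl⟩ _ ⟨y, subset_convexHull ℝ _ hy, rfl⟩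
  simp only [hf, AffineMap.homothety_apply, vadd_eq_add, vsub_eq_sub, map_add, map_smul,
    map_sub, smul_eq_mul] at h
  have e : (1 + δ) / δ = r⁻¹ := by rw [hr, inv_div]
  rw [e, ← div_eq_inv_mul, le_div_iff₀ hr0]
  linarith

lemma relDist_self {ι : Type*} (A : Set (ι → ℝ)) : relDist A A = 0 := by
  refine nonpos_iff_eq_zero.1 (iSup_le fun π => ?_)
  refine ENNReal.div_le_of_le_mul ?_
  rw [zero_mul]
  exact iSup₂_le fun b hb => iInf₂_le_of_le b hb (by simp)

lemma exists_affineSubspace_cover (l k : ℕ) {D : Set (Fin l → ℝ)} (hD : Convex ℝ D)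
    (σ : (Fin l → ℝ) →ᵃ[ℝ] (Fin k → ℝ)) {δ : ℝ} (hδ : 0 < δ) :
    ∃ 𝓗 : Finset (AffineSubspace ℝ (Fin l → ℝ)),
      (𝓗.card : ℝ≥0∞) ≤
          ∏ i ∈ Finset.Icc 1 k, (1 + ENNReal.ofReal ((1 + δ) / δ) * flatnessConst i) ∧
      (D ∩ {x | IsLatticePoint (σ x)} ⊆ ⋃ H ∈ 𝓗, (H : Set (Fin l → ℝ))) ∧
      ∀ H ∈ 𝓗,
        relDist (convexHull ℝ (D ∩ (H : Set (Fin l → ℝ)) ∩ {x | IsLatticePoint (σ x)}))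
          (D ∩ (H : Set (Fin l → ℝ))) ≤ ENNReal.ofReal δ := by
  classical
  induction k generalizing D with
  | zero =>
    refine ⟨{⊤}, by simp, by simp, fun H hH => ?_⟩
    have hall : {x | IsLatticePoint (σ x)} = Set.univ :=
      Set.eq_univ_of_forall fun x i => i.elim0
    rw [Finset.mem_singleton.1 hH, hall, AffineSubspace.top_coe, Set.inter_univ, Set.inter_univ,
      hD.convexHull_eq, relDist_self]
    exact zero_le
  | succ k ih =>
    rcases (D ∩ {x | IsLatticePoint (σ x)}).eq_empty_or_nonempty with hemp | hne
    · exact ⟨∅, by simp, by simp [hemp], by simp⟩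
    rcases le_or_gt (relDist (convexHull ℝ (D ∩ {x | IsLatticePoint (σ x)})) D)
      (ENNReal.ofReal δ) with hle | hlt
    · refine ⟨{⊤}, ?_, by simp, by simpa using hle⟩
      rw [Finset.card_singleton, Nat.cast_one]
      exact Finset.one_le_prod' fun i _ => le_self_add
    obtain ⟨U, T, hU, hTcard, hT⟩ := exists_lattice_slicing
      (Z := σ '' (D ∩ {x | IsLatticePoint (σ x)}))
      (by rintro _ ⟨x, hx, rfl⟩; exact hx.2) (hne.image σ) (c := (1 + δ) / δ) (by positivity)
      (fun hspan ε hε => exists_intForm_sub_le_of_lt_relDist hD σ hδ hlt hspan hε)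
    let first : (Fin l → ℝ) →ᵃ[ℝ] ℝ :=
      ((LinearMap.proj 0 ∘ₗ U.toLinearMap).toAffineMap).comp σ
    let rest : (Fin l → ℝ) →ᵃ[ℝ] (Fin k → ℝ) :=
      ((LinearMap.funLeft ℝ ℝ Fin.succ ∘ₗ U.toLinearMap).toAffineMap).comp σ
    have hfirst_apply : ∀ x, first x = U (σ x) 0 := fun x => rfl
    set G : ℤ → AffineSubspace ℝ (Fin l → ℝ) := fun t =>
      (AffineSubspace.mk' (t : ℝ) ⊥).comap first with hG
    have mem_G : ∀ t x, x ∈ G t ↔ U (σ x) 0 = t := by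
      intro t x
      rw [hG, AffineSubspace.mem_comap, AffineSubspace.mem_mk', Submodule.mem_bot,
        vsub_eq_zero_iff_eq, hfirst_apply]
    have lattice_iff : ∀ (t : ℤ) x, x ∈ G t →
        (IsLatticePoint (σ x) ↔ IsLatticePoint (rest x)) := by
      intro t x hx
      rw [← hU]
      refine ⟨fun h i => h i.succ, fun h i => ?_⟩
      exact Fin.cases ⟨t, (mem_G t x).1 hx⟩ h i
    choose 𝓕 hcard hcover hdist using fun t : ℤ => ih (hD.inter (G t).convex) rest
    refine ⟨T.biUnion fun t => (𝓕 t).image (G t ⊓ ·), ?_, ?_, ?_⟩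
    · rw [Finset.prod_Icc_succ_top (by omega), mul_comm]
      set P := ∏ i ∈ Finset.Icc 1 k, (1 + ENNReal.ofReal ((1 + δ) / δ) * flatnessConst i)
      calc _ ≤ ((∑ t ∈ T, ((𝓕 t).image (G t ⊓ ·)).card : ℕ) : ℝ≥0∞) := by
            exact_mod_cast Finset.card_biUnion_le
        _ ≤ ∑ t ∈ T, P := by
            rw [Nat.cast_sum]
            refine Finset.sum_le_sum fun t _ => le_trans ?_ (hcard t)
            exact_mod_cast Finset.card_image_le
        _ = T.card * P := by rw [Finset.sum_const, nsmul_eq_mul]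
        _ ≤ _ := by gcongr
    · rintro x ⟨hxD, hxl⟩
      obtain ⟨t, ht, hxt⟩ := hT _ ⟨x, ⟨hxD, hxl⟩, rfl⟩
      have hxG := (mem_G t x).2 hxt
      have := hcover t ⟨⟨hxD, hxG⟩, (lattice_iff t x hxG).1 hxl⟩
      simp only [Set.mem_iUnion] at this ⊢
      obtain ⟨H, hH, hxH⟩ := this
      exact ⟨G t ⊓ H, Finset.mem_biUnion.2 ⟨t, ht, Finset.mem_image_of_mem _ hH⟩, hxG, hxH⟩
    · intro H' hH'
      obtain ⟨t, -, hH'⟩ := Finset.mem_biUnion.1 hH'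
      obtain ⟨H, hH, rfl⟩ := Finset.mem_image.1 hH'
      have e1 : D ∩ ((G t ⊓ H : AffineSubspace ℝ (Fin l → ℝ)) : Set (Fin l → ℝ)) =
          D ∩ G t ∩ H := by
        rw [Set.inter_assoc]
        rfl
      have e2 : D ∩ G t ∩ H ∩ {x | IsLatticePoint (σ x)} =
          D ∩ G t ∩ H ∩ {x | IsLatticePoint (rest x)} := by
        ext x
        exact and_congr_right fun hx => lattice_iff t x hx.1.2
      rw [e1, e2]
      exact hdist t H hH

/-- For a convex set `D ⊆ ℝ^ℓ` and an affine map `σ : ℝ^ℓ → ℝ^k`, for every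
`δ > 0` there is a family `𝓗` of affine subspaces of `ℝ^ℓ` with
`|𝓗| ≤ ∏_{i=1}^k (1 + ((1+δ)/δ)·Flt(i))`, covering `D ∩ σ⁻¹(ℤ^k)`, such that
`rdist((D∩H)_σ, D∩H) ≤ δ` for each `H ∈ 𝓗`. -/
theorem divide_proposition (l k : ℕ) (hl : 0 < l) (hk : 0 < k)
    (D : Set (Fin l → ℝ)) (hD : Convex ℝ D)
    (σ : (Fin l → ℝ) →ᵃ[ℝ] (Fin k → ℝ)) (δ : ℝ) (hδ : 0 < δ) :
    ∃ 𝓗 : Finset (AffineSubspace ℝ (Fin l → ℝ)),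
      (𝓗.card : ℝ≥0∞) ≤
          ∏ i ∈ Finset.Icc 1 k, (1 + ENNReal.ofReal ((1 + δ) / δ) * flatnessConst i) ∧
      (D ∩ {x | IsLatticePoint (σ x)} ⊆ ⋃ H ∈ 𝓗, (H : Set (Fin l → ℝ))) ∧
      ∀ H ∈ 𝓗,
        relDist (convexHull ℝ (D ∩ (H : Set (Fin l → ℝ)) ∩ {x | IsLatticePoint (σ x)}))
          (D ∩ (H : Set (Fin l → ℝ))) ≤ ENNReal.ofReal δ := by
  exact exists_affineSubspace_cover l k hD σ hδ
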